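/- Let P ⊂ ℝ² be a finite set of point obstacles and let γ be a piecewise-linear loop whose image is disjoint from P. Then there exists a piecewise-linear loop δ (whose image may meet P) that is homotopic rel P in the extended sense to γ and has minimal length: every piecewise-linear loop homotopic rel P in the extended sense to γ has length at least the length of δ. -/

import Mathlib

/-!
Statement 0: existence of a shortest piecewise-linear loop homotopic rel `P`
(in the extended sense) to a given piecewise-linear loop avoiding `P`.
-/

noncomputable section

/-- The Euclidean plane. -/
abbrev Pt : Type := EuclideanSpace ℝ (Fin 2)

/-- A piecewise-linear loop, given by a cyclic sequence of `m ≥ 1` vertices. -/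
structure PLLoop where
  m : ℕ
  m_pos : 0 < m
  v : ZMod m → Pt

/-- The standard 1-periodic parametrization of a piecewise-linear loop: on the
interval `[i/m, (i+1)/m]` it traverses the straight segment from `v i` to `v (i+1)`. -/
def PLLoop.toFun (γ : PLLoop) : ℝ → Pt := fun t =>
  let x : ℝ := Int.fract t * γ.m
  let i : ℤ := ⌊x⌋
  (1 - (x - (i : ℝ))) • γ.v (i : ZMod γ.m) + (x - (i : ℝ)) • γ.v ((i + 1 : ℤ) : ZMod γ.m)

/-- The length of a piecewise-linear loop: the sum of the Euclidean lengths of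
its segments. -/
def PLLoop.length (γ : PLLoop) : ℝ :=
  ∑ i ∈ Finset.range γ.m, dist (γ.v (i : ZMod γ.m)) (γ.v ((i : ZMod γ.m) + 1))

/-- The image of a piecewise-linear loop in the plane. -/
def PLLoop.image (γ : PLLoop) : Set Pt := Set.range γ.toFun

/-- `γ` (avoiding `P`) is homotopic rel `P` in the extended sense to `δ` (which may
meet `P`): there is a continuous `H` on `[0,1] × S¹` (given here via 1-periodic maps
in the second variable) with `H(0,·) = γ`, `H(1,·) = δ`, and the image of `H(t,·)`
disjoint from `P` for every `t < 1`. -/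
def HomotopicRelExt (P : Set Pt) (γ δ : PLLoop) : Prop :=
  ∃ H : ℝ × ℝ → Pt, Continuous H ∧
    (∀ s : ℝ, H (0, s) = γ.toFun s) ∧
    (∀ s : ℝ, H (1, s) = δ.toFun s) ∧
    (∀ t s : ℝ, H (t, s + 1) = H (t, s)) ∧
    (∀ t s : ℝ, 0 ≤ t → t < 1 → H (t, s) ∉ P)

open Set Filter Topology

/-- `f` is the end of a homotopy starting at `g` that avoids `P` before its end time. -/
def ExtHtpy (P : Set Pt) (g f : ℝ → Pt) : Prop :=
  ∃ H : ℝ × ℝ → Pt, Continuous H ∧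
    (∀ s : ℝ, H (0, s) = g s) ∧
    (∀ s : ℝ, H (1, s) = f s) ∧
    (∀ t s : ℝ, H (t, s + 1) = H (t, s)) ∧
    (∀ t s : ℝ, 0 ≤ t → t < 1 → H (t, s) ∉ P)

namespace ExtHtpy

variable {P : Set Pt} {g f h : ℝ → Pt}

lemma refl (hg : Continuous g) (hper : ∀ s, g (s + 1) = g s) (hP : ∀ s, g s ∉ P) :
    ExtHtpy P g g :=
  ⟨fun x => g x.2, by fun_prop, fun _ => rfl, fun _ => rfl, fun _ s => hper s,
    fun _ s _ _ => hP s⟩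

lemma continuous_right (H : ExtHtpy P g f) : Continuous f := by
  obtain ⟨H, hc, -, h1, -, -⟩ := H
  have : f = fun s => H (1, s) := funext fun s => (h1 s).symm
  rw [this]; fun_prop

lemma periodic_right (H : ExtHtpy P g f) (s : ℝ) : f (s + 1) = f s := by
  obtain ⟨H, hc, -, h1, hp, -⟩ := H
  rw [← h1, ← h1, hp]

/-- A homotopy defined before time `1` and converging to `h` at time `1`. -/
lemma of_tendsto (hh : Continuous h) (hper : ∀ s, h (s + 1) = h s) (K : ℝ × ℝ → Pt)
    (hK : ∀ t s, t < 1 → ContinuousAt K (t, s)) (hK0 : ∀ s, K (0, s) = g s)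
    (hlim : ∀ s, Tendsto K (𝓝[{x | x.1 < 1}] (1, s)) (𝓝 (h s)))
    (hKper : ∀ t s, t < 1 → K (t, s + 1) = K (t, s))
    (hKP : ∀ t s : ℝ, 0 ≤ t → t < 1 → K (t, s) ∉ P) : ExtHtpy P g h := by
  refine ⟨fun x => if x.1 < 1 then K x else h x.2, ?_, ?_, ?_, ?_, ?_⟩
  · rw [continuous_iff_continuousAt]
    rintro ⟨t, s⟩
    rcases lt_trichotomy t 1 with ht | rfl | ht
    · refine (hK t s ht).congr ?_
      filter_upwards [(isOpen_lt continuous_fst continuous_const).mem_nhds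
        (show (t, s).1 < (1 : ℝ) from ht)] with x hx
      rw [if_pos hx]
    · rw [ContinuousAt, ← nhdsWithin_univ,
        ← Set.union_compl_self ({x : ℝ × ℝ | x.1 < 1}), nhdsWithin_union]
      simp only [lt_irrefl, if_false]
      refine Tendsto.sup ?_ ?_
      · refine (hlim s).congr' ?_
        filter_upwards [self_mem_nhdsWithin] with x hx
        exact (if_pos hx).symm
      · have : Tendsto (fun x : ℝ × ℝ => h x.2) (𝓝[{x : ℝ × ℝ | x.1 < 1}ᶜ] (1, s)) (𝓝 (h s)) :=
          ((hh.comp continuous_snd).tendsto (1, s)).mono_left nhdsWithin_le_nhds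
        refine this.congr' ?_
        filter_upwards [self_mem_nhdsWithin] with x hx
        exact (if_neg hx).symm
    · refine ContinuousAt.congr (f := fun x : ℝ × ℝ => h x.2) (by fun_prop) ?_
      filter_upwards [(isOpen_lt continuous_const continuous_fst).mem_nhds
        (show (1 : ℝ) < (t, s).1 from ht)] with x hx
      rw [if_neg (not_lt.2 (le_of_lt hx))]
  · intro s; simp [hK0]
  · intro s; simp
  · intro t s
    by_cases ht : t < 1
    · simp [ht, hKper]
    · simp [ht, hper]
  · intro t s h0 h1
    simpa [h1] using hKP t s h0 h1

lemma comp_reparam (H : ExtHtpy P g f) {θ : ℝ → ℝ} (hθ : Continuous θ)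
    (hθ1 : ∀ s, θ (s + 1) = θ s + 1) : ExtHtpy P g (fun s => f (θ s)) := by
  obtain ⟨H, hc, h0, h1, hp, hP⟩ := H
  refine ⟨fun x => H (x.1, x.2 + x.1 * (θ x.2 - x.2)), by fun_prop, ?_, ?_, ?_, ?_⟩
  · intro s; simp [h0]
  · intro s; simp [h1]
  · intro t s
    simp only [hθ1]
    rw [← hp t (s + t * (θ s - s))]
    congr 2; ring
  · intro t s ht ht'
    exact hP _ _ ht ht'

/-- The truncated first time at which a straight-line motion comes `2 * a`-close to `P`. -/
def hittingTime (P : Set Pt) (f h : ℝ → Pt) (x : ℝ × ℝ × ℝ) : ℝ :=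
  sInf ((fun σ => min 1 (σ + x.1 *
    max (Metric.infDist (f x.2.2 + σ • (h x.2.2 - f x.2.2)) P - 2 * x.2.1) 0)) '' Icc (0 : ℝ) 1)

lemma continuous_hittingTime (hf : Continuous f) (hh : Continuous h) :
    Continuous (hittingTime P f h) := by
  refine IsCompact.continuous_sInf (f := fun (x : ℝ × ℝ × ℝ) (σ : ℝ) => min 1 (σ + x.1 *
    max (Metric.infDist (f x.2.2 + σ • (h x.2.2 - f x.2.2)) P - 2 * x.2.1) 0)) isCompact_Icc ?_
  have := Metric.continuous_infDist_pt P
  simp only [Function.HasUncurry.uncurry]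
  fun_prop

lemma hittingTime_le {N a s σ : ℝ} (hN : 0 ≤ N) (hσ : σ ∈ Icc (0 : ℝ) 1) :
    hittingTime P f h (N, a, s) ≤ min 1 (σ + N *
    max (Metric.infDist (f s + σ • (h s - f s)) P - 2 * a) 0) := by
  refine csInf_le ⟨0, ?_⟩ ⟨σ, hσ, rfl⟩
  rintro _ ⟨σ, hσ, rfl⟩
  have := hσ.1
  positivity

lemma le_hittingTime {N a s c : ℝ} (hc : ∀ σ ∈ Icc (0 : ℝ) 1, c ≤ min 1 (σ + N *
    max (Metric.infDist (f s + σ • (h s - f s)) P - 2 * a) 0)) :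
    c ≤ hittingTime P f h (N, a, s) := by
  refine le_csInf ⟨_, 0, by simp, rfl⟩ ?_
  rintro _ ⟨σ, hσ, rfl⟩
  exact hc σ hσ

/-- If `f` is the end of a homotopy avoiding `P` before its end, and `f` can be moved in straight
lines to `h` such that no moving point meets `P` before its end, then so is `h`. -/
lemma straight (hP : P.Finite) (H : ExtHtpy P g f) (hh : Continuous h)
    (hper : ∀ s, h (s + 1) = h s)
    (hfh : ∀ s, f s = h s ∨ ∀ t : ℝ, 0 ≤ t → t < 1 → f s + t • (h s - f s) ∉ P) :
    ExtHtpy P g h := by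
  have hf := H.continuous_right
  have hfper := H.periodic_right
  obtain ⟨H, hc, h0, h1, hp, hHP⟩ := H
  rcases P.eq_empty_or_nonempty with rfl | hPne
  · refine ⟨fun x => H x + x.1 • (h x.2 - f x.2), by fun_prop, ?_, ?_, ?_, ?_⟩
    · intro s; simp [h0]
    · intro s; simp [h1]
    · intro t s; simp [hp, hper, hfper]
    · intro t s _ _; simp
  have hD := Metric.continuous_infDist_pt P
  set τ : ℝ × ℝ → ℝ := fun x => hittingTime P f h ((1 - x.1)⁻¹, ‖H x - f x.2‖, x.2) with hτ
  have hτ0 : ∀ t s, t < 1 → 0 ≤ τ (t, s) := fun t s ht => le_hittingTime fun σ hσ => by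
    have := hσ.1
    have : (0 : ℝ) < 1 - t := by linarith
    positivity
  have hτ1 : ∀ t s, t < 1 → τ (t, s) ≤ 1 := fun t s ht =>
    (hittingTime_le (inv_nonneg.2 (sub_nonneg.2 ht.le)) ⟨le_rfl, zero_le_one⟩).trans
      (min_le_left _ _)
  have hHt : ∀ s, Tendsto H (𝓝[{x | x.1 < 1}] (1, s)) (𝓝 (f s)) := fun s => by
    rw [← h1]
    exact (hc.tendsto _).mono_left nhdsWithin_le_nhds
  have hsnd : ∀ s, Tendsto (fun x : ℝ × ℝ => x.2) (𝓝[{x | x.1 < 1}] (1, s)) (𝓝 s) := fun s =>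
    (continuous_snd.tendsto ((1 : ℝ), s)).mono_left nhdsWithin_le_nhds
  have hfst : ∀ s : ℝ, Tendsto (fun x : ℝ × ℝ => x.1) (𝓝[{x | x.1 < 1}] (1, s)) (𝓝 1) := fun s =>
    (continuous_fst.tendsto ((1 : ℝ), s)).mono_left nhdsWithin_le_nhds
  refine of_tendsto hh hper (fun x => H x + (x.1 * τ x) • (h x.2 - f x.2)) ?_ ?_ ?_ ?_ ?_
  · intro t s ht
    have : ContinuousAt τ (t, s) := by
      refine (continuous_hittingTime hf hh).continuousAt.comp (f := fun x : ℝ × ℝ =>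
        ((1 - x.1)⁻¹, ‖H x - f x.2‖, x.2)) (ContinuousAt.prodMk ?_ (by fun_prop))
      exact ContinuousAt.inv₀ (by fun_prop) (by simpa using (sub_pos.2 ht).ne')
    fun_prop
  · intro s; simp [h0]
  · intro s
    by_cases hs : f s = h s
    · rw [← add_zero (h s), ← hs]
      refine (hHt s).add ?_
      have hz : Tendsto (fun x : ℝ × ℝ => ‖x.1 • (h x.2 - f x.2)‖) (𝓝[{x | x.1 < 1}] (1, s))
          (𝓝 0) := by
        have : Continuous fun x : ℝ × ℝ => ‖x.1 • (h x.2 - f x.2)‖ := by fun_prop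
        simpa [hs] using (this.tendsto (1, s)).mono_left nhdsWithin_le_nhds
      refine squeeze_zero_norm' ?_ hz
      filter_upwards [self_mem_nhdsWithin] with x hx
      rw [norm_smul, norm_smul, norm_mul]
      have : ‖τ x‖ ≤ 1 := by
        rw [Real.norm_eq_abs, abs_le]
        exact ⟨by linarith [hτ0 x.1 x.2 hx], hτ1 x.1 x.2 hx⟩
      gcongr
      exact mul_le_of_le_one_right (norm_nonneg _) this
    · have hav := (hfh s).resolve_left hs
      have hτlim : Tendsto τ (𝓝[{x | x.1 < 1}] (1, s)) (𝓝 1) := by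
        refine tendsto_order.2 ⟨fun c hc1 => ?_, fun c hc1 => ?_⟩
        · set c' := max c 0 with hc'
          have hc'1 : c' < 1 := max_lt hc1 one_pos
          have hc'0 : 0 ≤ c' := le_max_right _ _
          obtain ⟨b, hcb, hb1⟩ := exists_between hc'1
          have hne : (Icc (0 : ℝ) b).Nonempty := ⟨0, le_rfl, by linarith⟩
          set m : ℝ → ℝ := fun s => sInf ((fun σ =>
            Metric.infDist (f s + σ • (h s - f s)) P) '' Icc (0 : ℝ) b) with hm
          have hmc : Continuous m := by
            refine IsCompact.continuous_sInf (f := fun (s σ : ℝ) =>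
              Metric.infDist (f s + σ • (h s - f s)) P) isCompact_Icc ?_
            simp only [Function.HasUncurry.uncurry]
            fun_prop
          have hm0 : 0 < m s := by
            obtain ⟨σ, hσ, he⟩ := isCompact_Icc.exists_sInf_image_eq hne
              (f := fun σ => Metric.infDist (f s + σ • (h s - f s)) P)
              (by fun_prop)
            simp only [hm, he]
            exact (hP.isClosed.notMem_iff_infDist_pos hPne).1
              (hav σ hσ.1 (hσ.2.trans_lt hb1))
          have hlim1 : Tendsto (fun x : ℝ × ℝ => m x.2 - 2 * ‖H x - f x.2‖)
              (𝓝[{x | x.1 < 1}] (1, s)) (𝓝 (m s)) := by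
            have : Continuous fun x : ℝ × ℝ => m x.2 - 2 * ‖H x - f x.2‖ := by fun_prop
            simpa [h1] using (this.tendsto (1, s)).mono_left nhdsWithin_le_nhds
          have hlim2 : ∀ᶠ x in 𝓝[{x : ℝ × ℝ | x.1 < 1}] (1, s), 1 - x.1 < m s / 2 := by
            have := (hfst s).const_sub 1
            rw [sub_self] at this
            exact this.eventually_lt_const (half_pos hm0)
          filter_upwards [self_mem_nhdsWithin, hlim2,
            hlim1.eventually_const_lt (half_lt_self hm0)] with x hx hx2 hx3
          have hx' : 0 < 1 - x.1 := sub_pos.2 hx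
          refine (le_max_left c 0).trans_lt (hcb.trans_le (le_hittingTime fun σ hσ => ?_))
          refine le_min hb1.le ?_
          by_cases hσb : σ ≤ b
          · have hmσ : m x.2 ≤ Metric.infDist (f x.2 + σ • (h x.2 - f x.2)) P := by
              refine csInf_le ⟨0, ?_⟩ ⟨σ, ⟨hσ.1, hσb⟩, rfl⟩
              rintro _ ⟨_, _, rfl⟩
              exact Metric.infDist_nonneg
            have : 1 - x.1 ≤
                max (Metric.infDist (f x.2 + σ • (h x.2 - f x.2)) P - 2 * ‖H x - f x.2‖) 0 :=
              le_max_of_le_left (by linarith)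
            have := mul_le_mul_of_nonneg_left this (inv_nonneg.2 hx'.le)
            rw [inv_mul_cancel₀ hx'.ne'] at this
            linarith [hσ.1]
          · have : 0 ≤ (1 - x.1)⁻¹ *
                max (Metric.infDist (f x.2 + σ • (h x.2 - f x.2)) P - 2 * ‖H x - f x.2‖) 0 := by
              positivity
            linarith
        · filter_upwards [self_mem_nhdsWithin] with x hx
          exact (hτ1 x.1 x.2 hx).trans_lt hc1
      have hd : Tendsto (fun x : ℝ × ℝ => h x.2 - f x.2) (𝓝[{x | x.1 < 1}] (1, s))
          (𝓝 (h s - f s)) :=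
        (((hh.sub hf).tendsto s).comp (hsnd s))
      have := (hHt s).add (((hfst s).mul hτlim).smul hd)
      simpa using this
  · intro t s _
    simp [hτ, hittingTime, hp, hper, hfper]
  · intro t s ht0 ht1 hmem
    rcases hfh s with hs | hs
    · simp only [hs, sub_self, smul_zero, add_zero] at hmem
      exact hHP t s ht0 ht1 hmem
    · rcases (hτ0 t s ht1).eq_or_lt with hτz | hτz
      · simp only [← hτz, mul_zero, zero_smul, add_zero] at hmem
        exact hHP t s ht0 ht1 hmem
      · have hlt : t * τ (t, s) < τ (t, s) := by nlinarith
        have hle := hittingTime_le (P := P) (f := f) (h := h) (a := ‖H (t, s) - f s‖) (s := s)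
          (inv_nonneg.2 (sub_nonneg.2 ht1.le)) (σ := t * τ (t, s))
          ⟨by positivity, hlt.le.trans (hτ1 t s ht1)⟩
        have hfar : 2 * ‖H (t, s) - f s‖ <
            Metric.infDist (f s + (t * τ (t, s)) • (h s - f s)) P := by
          by_contra! hcon
          rw [max_eq_right (by linarith), mul_zero, add_zero] at hle
          exact absurd (hle.trans (min_le_right _ _)) (not_le.2 hlt)
        have := Metric.infDist_le_dist_of_mem (x := f s + (t * τ (t, s)) • (h s - f s)) hmem
        rw [dist_eq_norm, add_sub_add_right_eq_sub, norm_sub_rev] at this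
        linarith [norm_nonneg (H (t, s) - f s)]

/-- A reparametrization of the final loop, possibly with pauses, can be undone. -/
lemma of_comp_reparam {θ : ℝ → ℝ} (H : ExtHtpy P g (fun s => f (θ s))) (hf : Continuous f)
    (hper : ∀ s, f (s + 1) = f s) (hθ : Continuous θ) (hmono : Monotone θ)
    (hθ1 : ∀ s, θ (s + 1) = θ s + 1) : ExtHtpy P g f := by
  obtain ⟨H, hc, h0, h1, hp, hHP⟩ := H
  obtain ⟨M, hM⟩ : ∃ M, ∀ r, |θ r - r| ≤ M := by
    have hb := Function.Periodic.isBounded_of_continuous (f := fun r => θ r - r) (c := 1)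
      (fun r => by simp [hθ1]) one_ne_zero (by fun_prop)
    obtain ⟨M, hM⟩ := hb.exists_norm_le
    exact ⟨M, fun r => hM _ ⟨r, rfl⟩⟩
  set Φ : ℝ → ℝ → ℝ := fun t r => r + max t 0 * (θ r - r) with hΦ
  have hexp : ∀ t r r', t < 1 → (1 - max t 0) * |r - r'| ≤ |Φ t r - Φ t r'| := by
    intro t r r' ht
    have ht1 : max t 0 < 1 := max_lt ht one_pos
    have ht0 : 0 ≤ max t 0 := le_max_right _ _
    wlog hrr : r' ≤ r generalizing r r'
    · rw [abs_sub_comm r, abs_sub_comm (Φ t r)]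
      exact this r' r (le_of_not_ge hrr)
    rw [abs_of_nonneg (sub_nonneg.2 hrr)]
    refine le_trans ?_ (le_abs_self _)
    have := mul_le_mul_of_nonneg_left (hmono hrr) ht0
    simp only [hΦ]
    nlinarith
  have hsurj : ∀ t s, ∃ r, t < 1 → Φ t r = s := by
    intro t s
    by_cases ht : t < 1
    · have ht1 : max t 0 < 1 := max_lt ht one_pos
      have ht0 : 0 ≤ max t 0 := le_max_right _ _
      have hb : ∀ r, |max t 0 * (θ r - r)| ≤ M := fun r => by
        rw [abs_mul, abs_of_nonneg ht0]
        exact (mul_le_of_le_one_left (abs_nonneg _) ht1.le).trans (hM r)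
      have hcΦ : Continuous (Φ t) := by simp only [hΦ]; fun_prop
      obtain ⟨r, hr⟩ := mem_range_of_exists_le_of_exists_ge hcΦ (c := s)
        ⟨s - M, by have := (abs_le.1 (hb (s - M))).2; simp only [hΦ]; linarith⟩
        ⟨s + M, by have := (abs_le.1 (hb (s + M))).1; simp only [hΦ]; linarith⟩
      exact ⟨r, fun _ => hr⟩
    · exact ⟨0, fun h => absurd h ht⟩
  choose ρ hρ using hsurj
  have hinj : ∀ t r r', t < 1 → Φ t r = Φ t r' → r = r' := by
    intro t r r' ht he
    have h := hexp t r r' ht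
    have ht1 : max t 0 < 1 := max_lt ht one_pos
    rw [he, sub_self, abs_zero] at h
    have : |r - r'| ≤ 0 := by
      by_contra! hpos
      nlinarith
    exact sub_eq_zero.1 (abs_nonpos_iff.1 this)
  refine of_tendsto hf hper (fun x => H (x.1, ρ x.1 x.2)) ?_ ?_ ?_ ?_ ?_
  · intro t₀ s₀ ht₀
    have hρc : ContinuousAt (fun x : ℝ × ℝ => ρ x.1 x.2) (t₀, s₀) := by
      rw [ContinuousAt, tendsto_iff_dist_tendsto_zero]
      have hlim : Tendsto (fun x : ℝ × ℝ => (|x.2 - s₀| + |max x.1 0 - max t₀ 0| * M) /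
          (1 - max x.1 0)) (𝓝 (t₀, s₀)) (𝓝 0) := by
        have : ContinuousAt (fun x : ℝ × ℝ => (|x.2 - s₀| + |max x.1 0 - max t₀ 0| * M) /
          (1 - max x.1 0)) (t₀, s₀) := by
          refine ContinuousAt.div (by fun_prop) (by fun_prop) ?_
          have : max t₀ 0 < 1 := max_lt ht₀ one_pos
          exact (sub_pos.2 this).ne'
        simpa [ContinuousAt] using this
      refine squeeze_zero' (Eventually.of_forall fun _ => dist_nonneg) ?_ hlim
      filter_upwards [(isOpen_lt continuous_fst continuous_const).mem_nhds
        (show (t₀, s₀).1 < (1 : ℝ) from ht₀)] with x hx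
      have hx1 : max x.1 0 < 1 := max_lt hx one_pos
      rw [Real.dist_eq, le_div_iff₀ (sub_pos.2 hx1), mul_comm]
      refine (hexp x.1 _ _ hx).trans ?_
      rw [hρ x.1 x.2 hx]
      have : Φ x.1 (ρ t₀ s₀) = s₀ + (max x.1 0 - max t₀ 0) * (θ (ρ t₀ s₀) - ρ t₀ s₀) := by
        have := hρ t₀ s₀ ht₀
        simp only [hΦ] at this ⊢
        linarith
      rw [this, ← sub_sub]
      refine (abs_sub _ _).trans ?_
      rw [abs_mul]
      have := mul_le_mul_of_nonneg_left (hM (ρ t₀ s₀)) (abs_nonneg (max x.1 0 - max t₀ 0))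
      linarith
    fun_prop
  · intro s
    have := hρ 0 s one_pos
    simp only [hΦ, max_self, zero_mul, add_zero] at this
    simp [h0, this]
  · intro s
    set D : ℝ → ℝ := fun t => sSup ((fun r => dist (H (t, r)) (H (1, r))) '' Icc (0 : ℝ) 1) with hD
    have hDc : Continuous D := by
      refine IsCompact.continuous_sSup (f := fun (t r : ℝ) => dist (H (t, r)) (H (1, r)))
        isCompact_Icc ?_
      simp only [Function.HasUncurry.uncurry]
      fun_prop
    have hD1 : D 1 = 0 := by
      simp [hD]
    have hDle : ∀ t r, dist (H (t, r)) (H (1, r)) ≤ D t := by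
      intro t r
      have hpf : ∀ t, H (t, r) = H (t, Int.fract r) := fun t => by
        have : Function.Periodic (fun r => H (t, r)) 1 := hp t
        have := this.sub_int_mul_eq ⌊r⌋ (x := r)
        simp only [mul_one] at this
        rw [← this]; rfl
      rw [hpf, hpf 1]
      refine le_csSup (isCompact_Icc.bddAbove_image (by fun_prop))
        ⟨Int.fract r, ⟨Int.fract_nonneg r, (Int.fract_lt_one r).le⟩, rfl⟩
    have hθρ : Tendsto (fun x : ℝ × ℝ => θ (ρ x.1 x.2)) (𝓝[{x | x.1 < 1}] (1, s)) (𝓝 s) := by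
      rw [tendsto_iff_dist_tendsto_zero]
      have hlim : Tendsto (fun x : ℝ × ℝ => (1 - max x.1 0) * M + |x.2 - s|)
          (𝓝[{x | x.1 < 1}] (1, s)) (𝓝 0) := by
        have : Continuous fun x : ℝ × ℝ => (1 - max x.1 0) * M + |x.2 - s| := by fun_prop
        simpa using (this.tendsto (1, s)).mono_left nhdsWithin_le_nhds
      refine squeeze_zero' (Eventually.of_forall fun _ => dist_nonneg) ?_ hlim
      filter_upwards [self_mem_nhdsWithin] with x hx
      have hx1 : max x.1 0 < 1 := max_lt hx one_pos
      have hx2 := hρ x.1 x.2 hx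
      simp only [hΦ] at hx2
      have : θ (ρ x.1 x.2) - s =
          (1 - max x.1 0) * (θ (ρ x.1 x.2) - ρ x.1 x.2) + (x.2 - s) := by linarith
      rw [Real.dist_eq, this]
      refine (abs_add_le _ _).trans ?_
      rw [abs_mul, abs_of_pos (sub_pos.2 hx1)]
      have := mul_le_mul_of_nonneg_left (hM (ρ x.1 x.2)) (sub_pos.2 hx1).le
      linarith
    rw [tendsto_iff_dist_tendsto_zero]
    have hlim : Tendsto (fun x : ℝ × ℝ => D x.1 + dist (f (θ (ρ x.1 x.2))) (f s))
        (𝓝[{x | x.1 < 1}] (1, s)) (𝓝 0) := by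
      have hA := ((hDc.comp continuous_fst).tendsto ((1 : ℝ), s)).mono_left
        (nhdsWithin_le_nhds (s := {x : ℝ × ℝ | x.1 < 1}))
      have hB := tendsto_iff_dist_tendsto_zero.1 ((hf.tendsto s).comp hθρ)
      simpa [hD1] using hA.add hB
    refine squeeze_zero (fun _ => dist_nonneg) (fun x => ?_) hlim
    refine (dist_triangle _ (H (1, ρ x.1 x.2)) _).trans ?_
    rw [h1]
    have := hDle x.1 (ρ x.1 x.2)
    rw [h1] at this
    gcongr
  · intro t s ht
    have : ρ t (s + 1) = ρ t s + 1 := by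
      refine hinj t _ _ ht ?_
      have h3 := hρ t s ht
      rw [hρ t (s + 1) ht]
      simp only [hΦ, hθ1] at h3 ⊢
      linarith
    simp only [this, hp]
  · intro t s ht0 ht1
    exact hHP _ _ ht0 ht1

end ExtHtpy
/-- Piecewise-linear interpolation of a sequence indexed by the integers. -/
def interp {E : Type*} [AddCommGroup E] [Module ℝ E] (x : ℤ → E) (s : ℝ) : E :=
  (1 - (s - ⌊s⌋)) • x ⌊s⌋ + (s - ⌊s⌋) • x (⌊s⌋ + 1)

section Interp

variable {E : Type*} [AddCommGroup E] [Module ℝ E]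

lemma interp_of_mem (x : ℤ → E) {s : ℝ} {k : ℤ} (h1 : (k : ℝ) ≤ s) (h2 : s ≤ k + 1) :
    interp x s = (1 - (s - k)) • x k + (s - k) • x (k + 1) := by
  rcases h2.eq_or_lt with rfl | h2
  · have : ⌊(k : ℝ) + 1⌋ = k + 1 := by
      rw [Int.floor_eq_iff]; push_cast; constructor <;> linarith
    simp [interp, this]
  · have : ⌊s⌋ = k := Int.floor_eq_iff.2 ⟨h1, h2⟩
    rw [interp, this]

lemma interp_add_int (x : ℤ → E) (s : ℝ) (m : ℤ) :
    interp x (s + m) = interp (fun j => x (j + m)) s := by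
  rw [interp, interp, Int.floor_add_intCast]
  push_cast
  rw [add_sub_add_right_eq_sub, add_right_comm]

lemma interp_add_smul_sub (x y : ℤ → E) (s t : ℝ) :
    interp x s + t • (interp y s - interp x s) = interp (fun j => x j + t • (y j - x j)) s := by
  simp only [interp]; module

lemma continuous_interp [TopologicalSpace E] [ContinuousAdd E] [ContinuousSMul ℝ E] (x : ℤ → E) :
    Continuous (interp x) := by
  have key : ∀ k : ℤ, ContinuousOn (interp x) (Icc k (k + 1)) := fun k => by
    have : Continuous fun s : ℝ => (1 - (s - k)) • x k + (s - k) • x (k + 1) := by fun_prop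
    exact this.continuousOn.congr fun s hs => interp_of_mem x hs.1 hs.2
  rw [continuous_iff_continuousAt]
  intro s
  have h1 := key (⌊s⌋ - 1)
  have h2 := key ⌊s⌋
  push_cast at h1
  rw [sub_add_cancel] at h1
  have h := h1.union_of_isClosed h2 isClosed_Icc isClosed_Icc
  rw [Icc_union_Icc_eq_Icc (by linarith) (by linarith)] at h
  exact h.continuousAt (Icc_mem_nhds (by linarith [Int.floor_le s]) (Int.lt_floor_add_one s))

lemma interp_mem_Icc {a : ℤ → ℝ} {j : ℤ} (ha : a j ≤ a (j + 1)) {s : ℝ} (h1 : (j : ℝ) ≤ s)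
    (h2 : s ≤ j + 1) : interp a s ∈ Icc (a j) (a (j + 1)) := by
  rw [interp_of_mem a h1 h2]
  simp only [smul_eq_mul]
  constructor <;> nlinarith

lemma monotone_interp {a : ℤ → ℝ} (ha : ∀ j, a j ≤ a (j + 1)) : Monotone (interp a) := by
  have ham : Monotone a := monotone_int_of_le_succ ha
  intro s t hst
  have hs := interp_mem_Icc (ha ⌊s⌋) (Int.floor_le s) (Int.lt_floor_add_one s).le
  have ht := interp_mem_Icc (ha ⌊t⌋) (Int.floor_le t) (Int.lt_floor_add_one t).le
  rcases (Int.floor_le_floor hst).eq_or_lt with h | h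
  · rw [interp, interp, ← h]
    simp only [smul_eq_mul]
    have := ha ⌊s⌋
    nlinarith
  · exact hs.2.trans ((ham h).trans ht.1)

/-- Interpolation between points which consecutively lie on common edges is a reparametrization. -/
lemma interp_comp (x : ℤ → E) {a : ℤ → ℝ}
    (ha : ∀ j, a j ≤ a (j + 1) ∧ ∃ k : ℤ, (k : ℝ) ≤ a j ∧ a (j + 1) ≤ k + 1) (s : ℝ) :
    interp (fun j => interp x (a j)) s = interp x (interp a s) := by
  obtain ⟨haj, k, hk1, hk2⟩ := ha ⌊s⌋
  have hm := interp_mem_Icc haj (Int.floor_le s) (Int.lt_floor_add_one s).le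
  rw [interp_of_mem x (hk1.trans hm.1) (hm.2.trans hk2), interp,
    interp_of_mem x hk1 (haj.trans hk2), interp_of_mem x (hk1.trans haj) hk2]
  simp only [interp, smul_eq_mul]
  module

end Interp

section CyclicSequences

variable {n : ℕ} {x y : ℤ → Pt}

/-- The cyclic sequence of period `n + 1` obtained from one of period `n` by inserting `z` between
the entries at `0` and `1`. -/
def insertVertex (n : ℕ) (y : ℤ → Pt) (z : Pt) (j : ℤ) : Pt :=
  if j % (n + 1 : ℕ) = 0 then y 0 else if j % (n + 1 : ℕ) = 1 then z else y (j % (n + 1 : ℕ) - 1)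

lemma periodic_emod (hx : Function.Periodic x (n : ℤ)) (j : ℤ) : x (j % n) = x j := by
  have := hx.sub_int_mul_eq (j / n) (x := j)
  rw [← this, Int.emod_def, mul_comm]
  rfl

lemma periodic_ext (hn : 0 < n) (hx : Function.Periodic x (n : ℤ))
    (hy : Function.Periodic y (n : ℤ)) (h : ∀ j : ℤ, 0 ≤ j → j < n → x j = y j) : x = y := by
  funext j
  rw [← periodic_emod hx, ← periodic_emod hy]
  have : (0 : ℤ) < n := by exact_mod_cast hn
  exact h _ (Int.emod_nonneg _ this.ne') (Int.emod_lt_of_pos _ this)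

lemma insertVertex_periodic (n : ℕ) (y : ℤ → Pt) (z : Pt) :
    Function.Periodic (insertVertex n y z) ((n + 1 : ℕ) : ℤ) := fun j => by
  simp only [insertVertex, Int.add_emod_right]

lemma insertVertex_zero (n : ℕ) (y : ℤ → Pt) (z : Pt) (k : ℤ) :
    insertVertex n y z ((n + 1 : ℕ) * k) = y 0 := by
  simp [insertVertex]

lemma insertVertex_one (hn : 0 < n) (y : ℤ → Pt) (z : Pt) (k : ℤ) :
    insertVertex n y z ((n + 1 : ℕ) * k + 1) = z := by
  have : ((n + 1 : ℕ) * k + 1) % ((n + 1 : ℕ) : ℤ) = 1 := by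
    rw [Int.mul_add_emod_self_left]
    exact Int.emod_eq_of_lt (by norm_num) (by omega)
  rw [insertVertex, this, if_neg one_ne_zero, if_pos rfl]

lemma insertVertex_two (hy : Function.Periodic y (n : ℤ)) (z : Pt) (k : ℤ) {r : ℤ} (h2 : 2 ≤ r)
    (hr : r ≤ n + 1) : insertVertex n y z ((n + 1 : ℕ) * k + r) = y (r - 1) := by
  rcases hr.eq_or_lt with rfl | hr
  · have := insertVertex_zero n y z (k + 1)
    rw [mul_add, mul_one] at this
    push_cast at this ⊢
    rw [this, add_sub_cancel_right]
    simpa using (hy 0).symm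
  · have : ((n + 1 : ℕ) * k + r) % ((n + 1 : ℕ) : ℤ) = r := by
      rw [Int.mul_add_emod_self_left]
      exact Int.emod_eq_of_lt (by omega) (by push_cast; omega)
    rw [insertVertex, this, if_neg (by omega), if_neg (by omega)]

lemma insertVertex_at_zero (n : ℕ) (y : ℤ → Pt) (z : Pt) : insertVertex n y z 0 = y 0 := by
  simpa using insertVertex_zero n y z 0

lemma insertVertex_at_one (hn : 0 < n) (y : ℤ → Pt) (z : Pt) : insertVertex n y z 1 = z := by
  simpa using insertVertex_one hn y z 0

lemma insertVertex_of_two_le (hy : Function.Periodic y (n : ℤ)) (z : Pt) {r : ℤ} (h2 : 2 ≤ r)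
    (hr : r ≤ n + 1) : insertVertex n y z r = y (r - 1) := by
  simpa using insertVertex_two hy z 0 h2 hr

lemma periodic_shift (hx : Function.Periodic x (n : ℤ)) (k : ℤ) :
    Function.Periodic (fun j => x (j + k)) (n : ℤ) := fun j => by
  simpa [add_right_comm] using hx (j + k)

lemma shift_insertVertex_insertVertex (hn : 0 < n) (hy : Function.Periodic y (n : ℤ)) (q v : Pt) :
    (fun j => insertVertex (n + 1) (insertVertex n y v) q (j + 1)) =
      insertVertex (n + 1) (fun j => insertVertex n y q (j + 1)) v := by
  have hp := insertVertex_periodic n y v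
  have hp' := periodic_shift (insertVertex_periodic n y q) 1
  refine periodic_ext (n := n + 1 + 1) (by omega)
    (periodic_shift (insertVertex_periodic _ _ _) 1) (insertVertex_periodic _ _ _) ?_
  intro j h0 hj
  push_cast at hj
  obtain rfl | rfl | h2 : j = 0 ∨ j = 1 ∨ 2 ≤ j := by omega
  · simp only [zero_add]
    rw [insertVertex_at_one (by omega), insertVertex_at_zero, zero_add, insertVertex_at_one hn]
  · rw [insertVertex_of_two_le hp q (by norm_num) (by push_cast; omega),
      insertVertex_at_one (by omega)]
    simp [insertVertex_at_one hn]
  · rw [insertVertex_of_two_le hp q (by omega) (by push_cast; omega),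
      insertVertex_of_two_le hp' v h2 (by push_cast; omega), add_sub_cancel_right, sub_add_cancel,
      insertVertex_of_two_le hy v h2 (by omega), insertVertex_of_two_le hy q h2 (by omega)]

lemma exists_eq_insertVertex (hn : 0 < n) (hx : Function.Periodic x ((n + 1 : ℕ) : ℤ)) :
    ∃ y : ℤ → Pt, Function.Periodic y (n : ℤ) ∧ x = insertVertex n y (x 1) := by
  refine ⟨fun j => if j % n = 0 then x 0 else x (j % n + 1), fun j => by simp, ?_⟩
  set y : ℤ → Pt := fun j => if j % n = 0 then x 0 else x (j % n + 1) with hy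
  have hyp : Function.Periodic y (n : ℤ) := fun j => by simp [hy]
  refine periodic_ext (n := n + 1) (by omega) hx (insertVertex_periodic _ _ _) ?_
  intro j h0 hj
  push_cast at hj
  obtain rfl | rfl | h2 : j = 0 ∨ j = 1 ∨ 2 ≤ j := by omega
  · rw [insertVertex_at_zero]; simp [hy]
  · rw [insertVertex_at_one hn]
  · rw [insertVertex_of_two_le hyp _ h2 hj.le]
    have : (j - 1) % n = j - 1 := Int.emod_eq_of_lt (by omega) (by omega)
    simp only [hy, this]
    rw [if_neg (by omega), sub_add_cancel]

variable {M : Type*} [AddCancelCommMonoid M]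

/-- The sum of `F` over the edges of a cyclic sequence of period `n`. -/
def edgeSum (F : Pt → Pt → M) (n : ℕ) (x : ℤ → Pt) : M :=
  ∑ j ∈ Finset.range n, F (x j) (x (j + 1))

lemma edgeSum_shift_one (F : Pt → Pt → M) (hx : Function.Periodic x (n : ℤ)) :
    edgeSum F n (fun j => x (j + 1)) = edgeSum F n x := by
  have h1 := Finset.sum_range_succ (fun j : ℕ => F (x j) (x (j + 1))) n
  have h2 := Finset.sum_range_succ' (fun j : ℕ => F (x j) (x (j + 1))) n
  have h3 : F (x (n : ℤ)) (x (n + 1)) = F (x ((0 : ℕ) : ℤ)) (x ((0 : ℕ) + 1)) := by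
    have ha := hx 0
    have hb := hx 1
    rw [zero_add] at ha
    rw [add_comm] at hb
    simp [ha, hb]
  rw [h1, h3] at h2
  have := add_right_cancel h2
  simp only [edgeSum, this]
  push_cast
  rfl

lemma edgeSum_shift (F : Pt → Pt → M) (hx : Function.Periodic x (n : ℤ)) (k : ℕ) :
    edgeSum F n (fun j => x (j + k)) = edgeSum F n x := by
  induction k with
  | zero => simp
  | succ k ih =>
    rw [← ih, ← edgeSum_shift_one F (periodic_shift hx k)]
    push_cast
    simp only [add_assoc, add_comm (k : ℤ) 1]

lemma edgeSum_insertVertex (F : Pt → Pt → M) (hn : 0 < n) (hy : Function.Periodic y (n : ℤ))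
    (z : Pt) : edgeSum F (n + 1) (insertVertex n y z) + F (y 0) (y 1) =
      edgeSum F n y + (F (y 0) z + F z (y 1)) := by
  obtain ⟨n, rfl⟩ : ∃ m, n = m + 1 := ⟨n - 1, by omega⟩
  have hsum : ∀ j ∈ Finset.range n, F (insertVertex (n + 1) y z ((j + 1 + 1 : ℕ) : ℤ))
      (insertVertex (n + 1) y z ((j + 1 + 1 : ℕ) + 1)) =
        F (y ((j + 1 : ℕ) : ℤ)) (y ((j + 1 : ℕ) + 1)) := fun j hj => by
    have := Finset.mem_range.1 hj
    rw [insertVertex_of_two_le hy z (by push_cast; omega) (by push_cast; omega),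
      insertVertex_of_two_le hy z (by push_cast; omega) (by push_cast; omega)]
    push_cast
    simp
  have h2 : insertVertex (n + 1) y z (1 + 1) = y 1 := by
    rw [insertVertex_of_two_le hy z (by norm_num) (by push_cast; omega)]; simp
  rw [edgeSum, edgeSum, Finset.sum_range_succ', Finset.sum_range_succ', Finset.sum_range_succ',
    Finset.sum_congr rfl hsum]
  simp only [Nat.cast_zero, zero_add, Nat.cast_one, insertVertex_at_zero,
    insertVertex_at_one (Nat.succ_pos n), h2]
  abel

end CyclicSequences

/-- The closed polygon with cyclic vertex sequence `x` of period `n` is the end of a homotopy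
starting at `g` that avoids `P` before its end. -/
structure ExtPolygon (P : Set Pt) (g : ℝ → Pt) (n : ℕ) (x : ℤ → Pt) : Prop where
  pos : 0 < n
  periodic : Function.Periodic x (n : ℤ)
  extHtpy : ExtHtpy P g (fun s => interp x (n * s))

namespace ExtPolygon

variable {P : Set Pt} {g : ℝ → Pt} {n : ℕ} {x y : ℤ → Pt}

lemma interp_periodic (hx : Function.Periodic x (n : ℤ)) (s : ℝ) :
    interp x (s + n) = interp x s := by
  have := interp_add_int x s n
  rw [Int.cast_natCast] at this
  rw [this, show (fun j => x (j + n)) = x from funext hx]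

lemma shift (h : ExtPolygon P g n x) (k : ℤ) : ExtPolygon P g n (fun j => x (j + k)) := by
  refine ⟨h.pos, periodic_shift h.periodic k, ?_⟩
  have hn : (n : ℝ) ≠ 0 := by exact_mod_cast h.pos.ne'
  have := h.extHtpy.comp_reparam (θ := fun s => s + k / n) (by fun_prop) (fun s => by ring)
  convert this using 2 with s
  rw [← interp_add_int]
  congr 1
  field_simp

/-- The parameters, in a cyclic sequence of period `n`, of the vertices after insertion of a vertex
at parameter `c` of the first edge. -/
def insertParam (n : ℕ) (c : ℝ) (j : ℤ) : ℝ :=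
  n * (j / (n + 1 : ℕ) : ℤ) + if j % (n + 1 : ℕ) = 0 then 0 else if j % (n + 1 : ℕ) = 1 then c
    else (j % (n + 1 : ℕ) : ℤ) - 1

lemma insertParam_add (n : ℕ) (c : ℝ) (j : ℤ) :
    insertParam n c (j + (n + 1 : ℕ)) = insertParam n c j + n := by
  have h : (j + (n + 1 : ℕ)) / ((n + 1 : ℕ) : ℤ) = j / (n + 1 : ℕ) + 1 := by
    have := Int.add_mul_ediv_right j 1 (c := ((n + 1 : ℕ) : ℤ)) (by omega)
    rwa [one_mul] at this
  rw [insertParam, insertParam, Int.add_emod_right, h]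
  push_cast
  ring

lemma insertParam_zero (n : ℕ) (c : ℝ) (k : ℤ) : insertParam n c ((n + 1 : ℕ) * k) = n * k := by
  have : ((n + 1 : ℕ) : ℤ) ≠ 0 := by omega
  rw [insertParam, Int.mul_emod_right, Int.mul_ediv_cancel_left _ this]
  simp

lemma insertParam_one (hn : 0 < n) (c : ℝ) (k : ℤ) :
    insertParam n c ((n + 1 : ℕ) * k + 1) = n * k + c := by
  have h0 : ((n + 1 : ℕ) : ℤ) ≠ 0 := by omega
  have h1 : (1 : ℤ) % ((n + 1 : ℕ) : ℤ) = 1 := Int.emod_eq_of_lt (by norm_num) (by omega)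
  have h2 : (1 : ℤ) / ((n + 1 : ℕ) : ℤ) = 0 := Int.ediv_eq_zero_of_lt (by norm_num) (by omega)
  rw [insertParam, Int.mul_add_emod_self_left, Int.mul_add_ediv_left _ _ h0, h1, h2]
  simp

lemma insertParam_two (n : ℕ) (c : ℝ) (k : ℤ) {r : ℤ} (h2 : 2 ≤ r) (hr : r ≤ n + 1) :
    insertParam n c ((n + 1 : ℕ) * k + r) = n * k + (r - 1) := by
  rcases hr.eq_or_lt with rfl | hr
  · have := insertParam_zero n c (k + 1)
    rw [mul_add, mul_one] at this
    push_cast at this ⊢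
    rw [this]; ring
  · have h0 : ((n + 1 : ℕ) : ℤ) ≠ 0 := by omega
    have h3 : r % ((n + 1 : ℕ) : ℤ) = r := Int.emod_eq_of_lt (by omega) (by push_cast; omega)
    have h4 : r / ((n + 1 : ℕ) : ℤ) = 0 := Int.ediv_eq_zero_of_lt (by omega) (by push_cast; omega)
    rw [insertParam, Int.mul_add_emod_self_left, Int.mul_add_ediv_left _ _ h0, h3, h4,
      if_neg (by omega), if_neg (by omega)]
    simp

lemma exists_mul_add (n : ℕ) (j : ℤ) : ∃ k r : ℤ, j = (n + 1 : ℕ) * k + r ∧ 0 ≤ r ∧ r ≤ n := by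
  have h0 : (0 : ℤ) < ((n + 1 : ℕ) : ℤ) := by omega
  have := Int.emod_lt_of_pos j h0
  exact ⟨j / (n + 1 : ℕ), j % (n + 1 : ℕ), (Int.mul_ediv_add_emod _ _).symm,
    Int.emod_nonneg _ h0.ne', by push_cast at this ⊢; omega⟩

lemma insertParam_edge (hn : 0 < n) {c : ℝ} (hc : c ∈ Icc (0 : ℝ) 1) (j : ℤ) :
    insertParam n c j ≤ insertParam n c (j + 1) ∧ ∃ k : ℤ, (k : ℝ) ≤ insertParam n c j ∧
      insertParam n c (j + 1) ≤ k + 1 := by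
  obtain ⟨k, r, rfl, h0, hr⟩ := exists_mul_add n j
  rw [add_assoc]
  obtain rfl | rfl | h2 : r = 0 ∨ r = 1 ∨ 2 ≤ r := by omega
  · rw [add_zero, zero_add, insertParam_zero, insertParam_one hn]
    exact ⟨by linarith [hc.1], n * k, by push_cast; exact ⟨le_rfl, by linarith [hc.2]⟩⟩
  · rw [insertParam_one hn, insertParam_two _ _ _ (by norm_num) (by omega)]
    push_cast
    exact ⟨by linarith [hc.2], n * k, by push_cast; exact ⟨by linarith [hc.1], by linarith⟩⟩
  · rw [insertParam_two _ _ _ h2 (by omega), insertParam_two _ _ _ (by omega) (by omega)]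
    push_cast
    exact ⟨by linarith, n * k + (r - 1), by push_cast; exact ⟨le_rfl, by linarith⟩⟩

lemma insertVertex_eq_interp (hn : 0 < n) (hy : Function.Periodic y (n : ℤ)) {c : ℝ}
    (hc : c ∈ Icc (0 : ℝ) 1) :
    insertVertex n y (y 0 + c • (y 1 - y 0)) = fun j => interp y (insertParam n c j) := by
  have hyk : ∀ k i : ℤ, y (n * k + i) = y i := fun k i => by
    have := (hy.int_mul k) i
    rw [← this]; congr 1; push_cast; ring
  funext j
  obtain ⟨k, r, rfl, h0, hr⟩ := exists_mul_add n j
  have hint : ∀ m : ℤ, interp y m = y m := fun m => by simp [interp]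
  obtain rfl | rfl | h2 : r = 0 ∨ r = 1 ∨ 2 ≤ r := by omega
  · rw [add_zero, insertVertex_zero, insertParam_zero]
    have := hint (n * k)
    push_cast at this
    rw [this]
    simpa using (hyk k 0).symm
  · rw [insertVertex_one hn, insertParam_one hn,
      interp_of_mem y (k := n * k) (by push_cast; linarith [hc.1]) (by push_cast; linarith [hc.2]),
      hyk k 1]
    have := hyk k 0
    rw [add_zero] at this
    rw [this]
    push_cast
    rw [add_sub_cancel_left]
    module
  · rw [insertVertex_two hy _ _ h2 (by omega), insertParam_two _ _ _ h2 (by omega)]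
    have := hint (n * k + (r - 1))
    push_cast at this
    rw [this, hyk]

lemma insertVertex_reparam (hn : 0 < n) (hy : Function.Periodic y (n : ℤ)) {c : ℝ}
    (hc : c ∈ Icc (0 : ℝ) 1) : ∃ θ : ℝ → ℝ, Continuous θ ∧ Monotone θ ∧
      (∀ s, θ (s + 1) = θ s + 1) ∧ ∀ s,
        interp (insertVertex n y (y 0 + c • (y 1 - y 0))) ((n + 1 : ℕ) * s) =
          interp y (n * θ s) := by
  have hn0 : (n : ℝ) ≠ 0 := by exact_mod_cast hn.ne'
  have hcont := continuous_interp (insertParam n c)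
  refine ⟨fun s => interp (insertParam n c) ((n + 1 : ℕ) * s) / n, by fun_prop, ?_, ?_, ?_⟩
  · intro s t hst
    have := monotone_interp (fun j => (insertParam_edge hn hc j).1)
      (mul_le_mul_of_nonneg_left hst (Nat.cast_nonneg (n + 1)))
    simp only
    gcongr
  · intro s
    have h1 := interp_add_int (insertParam n c) ((n + 1 : ℕ) * s) (n + 1 : ℕ)
    rw [Int.cast_natCast] at h1
    have h2 : interp (fun j => insertParam n c (j + (n + 1 : ℕ))) ((n + 1 : ℕ) * s) =
        interp (insertParam n c) ((n + 1 : ℕ) * s) + n := by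
      simp only [insertParam_add, interp, smul_eq_mul]
      ring
    beta_reduce
    rw [mul_add, mul_one, h1, h2]
    field_simp
  · intro s
    rw [insertVertex_eq_interp hn hy hc, interp_comp y (insertParam_edge hn hc),
      mul_div_cancel₀ _ hn0]

lemma subdivide (h : ExtPolygon P g n y) {c : ℝ} (hc : c ∈ Icc (0 : ℝ) 1) :
    ExtPolygon P g (n + 1) (insertVertex n y (y 0 + c • (y 1 - y 0))) := by
  obtain ⟨θ, hθ, -, hθ1, hθe⟩ := insertVertex_reparam h.pos h.periodic hc
  refine ⟨by omega, insertVertex_periodic _ _ _, ?_⟩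
  simp only [hθe]
  exact h.extHtpy.comp_reparam hθ hθ1

lemma of_subdivide (hn : 0 < n) (hy : Function.Periodic y (n : ℤ)) {c : ℝ}
    (hc : c ∈ Icc (0 : ℝ) 1)
    (h : ExtPolygon P g (n + 1) (insertVertex n y (y 0 + c • (y 1 - y 0)))) :
    ExtPolygon P g n y := by
  obtain ⟨θ, hθ, hmono, hθ1, hθe⟩ := insertVertex_reparam hn hy hc
  refine ⟨hn, hy, ?_⟩
  have h1 := h.extHtpy
  simp only [hθe] at h1
  refine ExtHtpy.of_comp_reparam (f := fun s => interp y (n * s)) h1 ?_ ?_ hθ hmono hθ1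
  · have := continuous_interp y
    fun_prop
  · intro s
    rw [mul_add, mul_one, interp_periodic hy]

lemma move (hP : P.Finite) (hn : 0 < n) (hy : Function.Periodic y (n : ℤ)) {v v' : Pt}
    (h : ExtPolygon P g (n + 1) (insertVertex n y v))
    (h0 : ∀ t l : ℝ, 0 ≤ t → t < 1 → 0 < l → l ≤ 1 →
      (1 - l) • y 0 + l • (v + t • (v' - v)) ∉ P)
    (h1 : ∀ t l : ℝ, 0 ≤ t → t < 1 → 0 ≤ l → l < 1 →
      (1 - l) • (v + t • (v' - v)) + l • y 1 ∉ P) :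
    ExtPolygon P g (n + 1) (insertVertex n y v') := by
  have hper := insertVertex_periodic n y v'
  refine ⟨by omega, hper, h.extHtpy.straight hP ?_ ?_ ?_⟩
  · have := continuous_interp (insertVertex n y v')
    fun_prop
  · intro s
    rw [mul_add, mul_one, interp_periodic hper]
  · intro s
    simp only [interp_add_smul_sub]
    set σ : ℝ := (n + 1 : ℕ) * s
    obtain ⟨k, r, hk, hr0, hr⟩ := exists_mul_add n ⌊σ⌋
    have hσ1 := Int.floor_le σ
    have hσ2 := Int.lt_floor_add_one σ
    simp only [interp, hk, add_assoc]
    rw [hk] at hσ1 hσ2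
    obtain rfl | rfl | h2 : r = 0 ∨ r = 1 ∨ 2 ≤ r := by omega
    · rw [add_zero] at *
      simp only [zero_add, insertVertex_zero, insertVertex_one hn, sub_self, smul_zero, add_zero]
      rcases hσ1.eq_or_lt with hσ | hσ
      · left; rw [← hσ]; simp
      · right
        intro t ht0 ht1
        exact h0 t _ ht0 ht1 (by linarith) (by linarith)
    · right
      intro t ht0 ht1
      simp only [insertVertex_one hn,
        insertVertex_two hy _ k (show (2 : ℤ) ≤ 1 + 1 by norm_num) (by omega)]
      simp only [sub_self, smul_zero, add_zero, add_sub_cancel_right]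
      exact h1 t _ ht0 ht1 (by linarith) (by linarith)
    · left
      simp only [insertVertex_two hy _ k h2 (by omega),
        insertVertex_two hy _ k (show (2 : ℤ) ≤ r + 1 by omega) (by omega)]

end ExtPolygon

/-- The number of vertices outside `P` in a cyclic sequence of period `n`. -/
def offCount (P : Set Pt) (n : ℕ) (x : ℤ → Pt) : ℕ :=
  edgeSum (fun a _ => Pᶜ.indicator (fun _ => 1) a) n x

/-- A point of the segment from `u` to `v` closest to `v` among `u` and the points of `P`. -/
lemma exists_clear_segment {P : Set Pt} (hP : P.Finite) (u : Pt) {v : Pt} (hv : v ∉ P) :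
    ∃ c ∈ Icc (0 : ℝ) 1, (u + c • (v - u) = u ∨ u + c • (v - u) ∈ P) ∧
      ∀ l : ℝ, 0 < l → l ≤ 1 → (1 - l) • (u + c • (v - u)) + l • v ∉ P := by
  have hcl : IsClosed ((fun c : ℝ => u + c • (v - u)) ⁻¹' P) :=
    hP.isClosed.preimage (by fun_prop)
  have hcpt : IsCompact ((Icc (0 : ℝ) 1 ∩ (fun c : ℝ => u + c • (v - u)) ⁻¹' P) ∪ {0}) :=
    (isCompact_Icc.inter_right hcl).union isCompact_singleton
  obtain ⟨c, hc, hmax⟩ := hcpt.exists_isGreatest ⟨0, by simp⟩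
  have hc' : c ∈ Icc (0 : ℝ) 1 ∧ (u + c • (v - u) = u ∨ u + c • (v - u) ∈ P) := by
    rcases hc with ⟨h1, h2⟩ | rfl
    · exact ⟨h1, Or.inr h2⟩
    · simp
  have hc1 : c < 1 := by
    rcases hc with ⟨h1, h2⟩ | rfl
    · refine h1.2.lt_of_ne ?_
      rintro rfl
      exact hv (by simpa using h2)
    · norm_num
  refine ⟨c, hc'.1, hc'.2, fun l h0 h1 hl => ?_⟩
  have he : (1 - l) • (u + c • (v - u)) + l • v = u + (c + l * (1 - c)) • (v - u) := by module
  rw [he] at hl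
  have hpos : 0 < l * (1 - c) := mul_pos h0 (by linarith)
  have := hmax (Or.inl ⟨⟨by linarith [hc'.1.1], by nlinarith⟩, hl⟩)
  linarith

namespace ExtPolygon

variable {P : Set Pt} {g : ℝ → Pt} {n : ℕ} {y : ℤ → Pt} {v : Pt}

lemma insertVertex_at_two (hn : 0 < n) (hy : Function.Periodic y (n : ℤ)) (z : Pt) :
    insertVertex n y z (1 + 1) = y 1 := by
  rw [insertVertex_of_two_le hy z (by norm_num) (by omega)]; simp

lemma dist_add_smul_sub {u v : Pt} {c : ℝ} (hc : c ∈ Icc (0 : ℝ) 1) :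
    dist u (u + c • (v - u)) + dist (u + c • (v - u)) v = dist u v := by
  refine dist_add_dist_of_mem_segment ⟨1 - c, c, by linarith [hc.2], hc.1, by ring, by module⟩

/-- Subdivision of the edge before the vertex `v`. -/
lemma subdivide_before (hn : 0 < n) (hy : Function.Periodic y (n : ℤ))
    (h : ExtPolygon P g (n + 1) (insertVertex n y v)) {c : ℝ} (hc : c ∈ Icc (0 : ℝ) 1)
    (hcP : y 0 + c • (v - y 0) ∈ P) :
    ∃ y' : ℤ → Pt, Function.Periodic y' ((n + 1 : ℕ) : ℤ) ∧ y' 0 = y 0 + c • (v - y 0) ∧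
      y' 1 = y 1 ∧ ExtPolygon P g (n + 1 + 1) (insertVertex (n + 1) y' v) ∧
      edgeSum dist (n + 1 + 1) (insertVertex (n + 1) y' v) =
        edgeSum dist (n + 1) (insertVertex n y v) ∧
      offCount P (n + 1 + 1) (insertVertex (n + 1) y' v) =
        offCount P (n + 1) (insertVertex n y v) := by
  have hp := h.periodic
  set p := y 0 + c • (v - y 0) with hpdef
  have h2 := (h.subdivide hc).shift 1
  have hF : ∀ {M : Type} [AddCancelCommMonoid M] (F : Pt → Pt → M),
      edgeSum F (n + 1 + 1) (insertVertex (n + 1) (fun j => insertVertex n y p (j + 1)) v) +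
        F (y 0) v = edgeSum F (n + 1) (insertVertex n y v) + (F (y 0) p + F p v) := by
    intro M _ F
    rw [← shift_insertVertex_insertVertex hn hy, edgeSum_shift_one F (insertVertex_periodic _ _ _)]
    have := edgeSum_insertVertex F (Nat.succ_pos n) hp p
    rwa [insertVertex_at_zero, insertVertex_at_one hn] at this
  rw [insertVertex_at_zero, insertVertex_at_one hn, shift_insertVertex_insertVertex hn hy] at h2
  refine ⟨_, periodic_shift (insertVertex_periodic n y p) 1, ?_, ?_, h2, ?_, ?_⟩
  · simp [insertVertex_at_one hn]
  · exact insertVertex_at_two hn hy p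
  · have := hF (dist : Pt → Pt → ℝ)
    rw [dist_add_smul_sub hc] at this
    exact add_right_cancel this
  · have := hF (fun a _ => Pᶜ.indicator (fun _ => 1) a)
    rw [indicator_of_notMem (a := p) (by simpa using hcP), add_zero] at this
    exact add_right_cancel this

/-- Subdivision of the edge after the vertex `v`. -/
lemma subdivide_after (hn : 0 < n) (hy : Function.Periodic y (n : ℤ))
    (h : ExtPolygon P g (n + 1) (insertVertex n y v)) {c : ℝ} (hc : c ∈ Icc (0 : ℝ) 1)
    (hcP : v + c • (y 1 - v) ∈ P) :
    ∃ y' : ℤ → Pt, Function.Periodic y' ((n + 1 : ℕ) : ℤ) ∧ y' 0 = y 0 ∧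
      y' 1 = v + c • (y 1 - v) ∧ ExtPolygon P g (n + 1 + 1) (insertVertex (n + 1) y' v) ∧
      edgeSum dist (n + 1 + 1) (insertVertex (n + 1) y' v) =
        edgeSum dist (n + 1) (insertVertex n y v) ∧
      offCount P (n + 1 + 1) (insertVertex (n + 1) y' v) =
        offCount P (n + 1) (insertVertex n y v) := by
  set q := v + c • (y 1 - v) with hqdef
  have h2 := (h.shift 1).subdivide hc
  have hs := shift_insertVertex_insertVertex hn hy v q
  have hz0 : insertVertex n y v (0 + 1) = v := by rw [zero_add, insertVertex_at_one hn]
  have hz1 := insertVertex_at_two hn hy v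
  have hF : ∀ {M : Type} [AddCancelCommMonoid M] (F : Pt → Pt → M),
      edgeSum F (n + 1 + 1) (insertVertex (n + 1) (insertVertex n y q) v) + F v (y 1) =
        edgeSum F (n + 1) (insertVertex n y v) + (F v q + F q (y 1)) := by
    intro M _ F
    rw [← edgeSum_shift_one F (insertVertex_periodic _ _ _), hs]
    have := edgeSum_insertVertex F (Nat.succ_pos n) (h.shift 1).periodic q
    rwa [hz0, hz1, edgeSum_shift_one F h.periodic] at this
  rw [hz0, hz1, ← hqdef, ← hs] at h2
  have h3 := h2.shift (-1)
  simp only [neg_add_cancel_right] at h3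
  refine ⟨_, insertVertex_periodic n y q, insertVertex_at_zero _ _ _, insertVertex_at_one hn _ _,
    h3, ?_, ?_⟩
  · have := hF (dist : Pt → Pt → ℝ)
    rw [dist_add_smul_sub hc] at this
    exact add_right_cancel this
  · have := hF (fun a _ => Pᶜ.indicator (fun _ => 1) a)
    rw [indicator_of_notMem (a := q) (by simpa using hcP), add_zero] at this
    exact add_right_cancel this

/-- Removal of a vertex joined to its predecessor and successor by half-open edges avoiding `P`:
the vertex is pulled towards its successor until the edge from its predecessor hits an obstacle,
at which the polygon is bent. -/
lemma remove_vertex (hP : P.Finite) (k : ℕ) : ∀ {n : ℕ} {y : ℤ → Pt} {v : Pt}, 0 < n →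
    Function.Periodic y (n : ℤ) → ExtPolygon P g (n + 1) (insertVertex n y v) →
    (∀ l : ℝ, 0 < l → l ≤ 1 → (1 - l) • y 0 + l • v ∉ P) →
    (∀ l : ℝ, 0 ≤ l → l < 1 → (1 - l) • v + l • y 1 ∉ P) →
    {x ∈ P | x ≠ y 0 ∧ ∃ a b d : ℝ, 0 ≤ a ∧ 0 ≤ b ∧ 0 ≤ d ∧ a + b + d = 1 ∧
      x = a • y 0 + b • v + d • y 1}.ncard ≤ k →
    ∃ (n' : ℕ) (x' : ℤ → Pt), ExtPolygon P g n' x' ∧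
      edgeSum dist n' x' ≤ edgeSum dist (n + 1) (insertVertex n y v) ∧
      offCount P n' x' + 1 = offCount P (n + 1) (insertVertex n y v) := by
  induction k using Nat.strong_induction_on with
  | _ k ih =>
  intro n y v hn hy h hl hr hk
  set u := y 0 with hu
  set w := y 1 with hw
  have hvP : v ∉ P := by simpa using hl 1 one_pos le_rfl
  have hzP : ∀ τ : ℝ, 0 ≤ τ → τ < 1 → v + τ • (w - v) ∉ P := fun τ h0 h1 => by
    have := hr τ h0 h1
    rwa [show (1 - τ) • v + τ • w = v + τ • (w - v) by module] at this
  set B : Set ℝ := {τ | τ ∈ Icc (0 : ℝ) 1 ∧ ∃ l ∈ Icc (0 : ℝ) 1,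
    (1 - l) • u + l • (v + τ • (w - v)) ∈ P \ {u}} with hB
  have hBcpt : IsCompact B := by
    have hcl : IsClosed ((fun x : ℝ × ℝ => (1 - x.2) • u + x.2 • (v + x.1 • (w - v))) ⁻¹'
        (P \ {u})) := (hP.sdiff).isClosed.preimage (by fun_prop)
    have := (((isCompact_Icc (a := (0 : ℝ)) (b := 1)).prod
      (isCompact_Icc (a := (0 : ℝ)) (b := 1))).inter_right hcl).image
      (f := (Prod.fst : ℝ × ℝ → ℝ)) continuous_fst
    convert this using 1
    ext τ
    constructor
    · rintro ⟨h1, l, h2, h3⟩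
      exact ⟨(τ, l), ⟨⟨h1, h2⟩, h3⟩, rfl⟩
    · rintro ⟨⟨τ, l⟩, ⟨⟨h1, h2⟩, h3⟩, rfl⟩
      exact ⟨h1, l, h2, h3⟩
  obtain ⟨τ, hτ, hmin⟩ := (hBcpt.union (isCompact_singleton (x := (1 : ℝ)))).exists_isLeast
    ⟨1, by simp⟩
  have hτ1 : τ ≤ 1 := hmin (by simp)
  have hτ0 : 0 < τ := by
    rcases hτ with ⟨⟨h0, -⟩, l, hl01, hlP⟩ | rfl
    · refine h0.lt_of_ne ?_
      rintro rfl
      rw [zero_smul, add_zero] at hlP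
      refine hl l (hl01.1.lt_of_ne ?_) hl01.2 hlP.1
      rintro rfl
      exact hlP.2 (by simp)
    · norm_num
  have hclear : ∀ σ l : ℝ, 0 ≤ σ → σ < τ → 0 < l → l ≤ 1 →
      (1 - l) • u + l • (v + σ • (w - v)) ∉ P := by
    intro σ l h0 h1 hl0 hl1 hmem
    have hne : (1 - l) • u + l • (v + σ • (w - v)) ≠ u := by
      intro he
      have h3 : l • (v + σ • (w - v)) = l • u := by
        rw [← sub_eq_zero] at he ⊢
        rw [← he]; module
      have h4 := smul_right_injective Pt hl0.ne' h3
      rw [he, ← h4] at hmem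
      exact hzP σ h0 (by linarith) hmem
    have := hmin (Or.inl ⟨⟨h0, by linarith⟩, l, ⟨hl0.le, hl1⟩, hmem, hne⟩)
    linarith
  set v' := v + τ • (w - v) with hv'
  have hv't : ∀ t : ℝ, v + t • (v' - v) = v + (t * τ) • (w - v) := fun t => by
    rw [hv']; module
  have hmove : ExtPolygon P g (n + 1) (insertVertex n y v') := by
    refine move hP hn hy h ?_ ?_
    · intro t l h0 h1 hl0 hl1
      rw [hv't]
      exact hclear _ l (by positivity) (by nlinarith) hl0 hl1
    · intro t l h0 h1 hl0 hl1
      rw [hv't, ← hw, show (1 - l) • (v + (t * τ) • (w - v)) + l • w =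
        v + (1 - (1 - l) * (1 - t * τ)) • (w - v) by module]
      have h3 : t * τ < 1 := by nlinarith
      have h4 : 0 ≤ t * τ := by positivity
      have h5 : 0 < (1 - l) * (1 - t * τ) := mul_pos (by linarith) (by linarith)
      refine hzP _ ?_ (by linarith)
      nlinarith
  have hlen : ∀ z : Pt, edgeSum dist (n + 1) (insertVertex n y z) + dist u w =
      edgeSum dist n y + (dist u z + dist z w) := edgeSum_insertVertex dist hn hy
  have hoff : ∀ z : Pt, z ∉ P → offCount P (n + 1) (insertVertex n y z) = offCount P n y + 1 :=
    fun z hz => by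
      have := edgeSum_insertVertex (fun a _ => Pᶜ.indicator (fun _ => 1) a) hn hy z
      rw [indicator_of_mem (a := z) (by simpa using hz)] at this
      unfold offCount
      omega
  rcases hτ1.eq_or_lt with rfl | hτ1
  · have he : v' = u + (1 : ℝ) • (w - u) := by rw [hv']; module
    rw [he] at hmove
    refine ⟨n, y, of_subdivide hn hy (by norm_num) hmove, ?_, (hoff v hvP).symm⟩
    linarith [hlen v, dist_triangle u v w]
  have hv'P : v' ∉ P := hzP τ hτ0.le hτ1
  obtain ⟨-, l, hl01, hlP⟩ : τ ∈ B := hτ.resolve_right hτ1.ne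
  obtain ⟨c, hc, hcp, hcl⟩ := exists_clear_segment (hP.sdiff (t := {u})) u
    (fun hmem => hv'P hmem.1 : v' ∉ P \ {u})
  set p := u + c • (v' - u) with hp
  have hpu : p ≠ u := by
    intro he
    rw [he] at hcl
    refine hcl l (hl01.1.lt_of_ne ?_) hl01.2 hlP
    rintro rfl
    exact hlP.2 (by simp)
  have hpP : p ∈ P := (hcp.resolve_left hpu).1
  have hc0 : 0 < c := by
    refine hc.1.lt_of_ne ?_
    rintro rfl
    exact hpu (by simp [hp])
  obtain ⟨y', hy', hy'0, hy'1, h', hlen', hoff'⟩ := subdivide_before hn hy hmove hc hpP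
  rw [← hp] at hy'0
  rw [← hw] at hy'1
  have hsub : {x ∈ P | x ≠ y' 0 ∧ ∃ a b d : ℝ, 0 ≤ a ∧ 0 ≤ b ∧ 0 ≤ d ∧ a + b + d = 1 ∧
      x = a • y' 0 + b • v' + d • y' 1} ⊂ {x ∈ P | x ≠ u ∧ ∃ a b d : ℝ, 0 ≤ a ∧ 0 ≤ b ∧ 0 ≤ d ∧
      a + b + d = 1 ∧ x = a • u + b • v + d • w} := by
    rw [hy'0, hy'1, ssubset_iff_of_subset]
    · refine ⟨p, ⟨hpP, hpu, 1 - c, c * (1 - τ), c * τ, by linarith [hc.2],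
        mul_nonneg hc0.le (by linarith), by positivity, by ring, by rw [hp, hv']; module⟩, ?_⟩
      exact fun hmem => hmem.2.1 rfl
    · rintro x ⟨hxP, hxp, a, b, d, ha, hb, hd, habd, hx⟩
      have hc1 := hc.2
      refine ⟨hxP, ?_, a * (1 - c), (a * c + b) * (1 - τ), (a * c + b) * τ + d,
        mul_nonneg ha (by linarith), mul_nonneg (by positivity) (by linarith), by positivity,
        by linear_combination habd, by rw [hx, hp, hv']; module⟩
      rintro rfl
      have hs : 0 < 1 - a * (1 - c) := by nlinarith
      have h1 : (1 - a * (1 - c)) • u = (1 - a * (1 - c)) • v +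
          ((a * c + b) * τ + d) • (w - v) := by
        have h2 : u = a • (u + c • (v' - u)) + b • v' + d • w := hx
        obtain rfl : b = 1 - a - d := by linarith
        rw [sub_smul, one_smul]
        nth_rw 1 [h2]
        rw [hv']; module
      have h2 : u = v + (((a * c + b) * τ + d) / (1 - a * (1 - c))) • (w - v) := by
        refine smul_right_injective Pt hs.ne' ?_
        simp only [h1, smul_add, smul_smul]
        rw [mul_div_cancel₀ _ hs.ne']
      have h3 : (a * c + b) * τ + d ≤ 1 - a * (1 - c) := by
        have : 0 ≤ (a * c + b) * (1 - τ) := mul_nonneg (by positivity) (by linarith)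
        linarith
      rcases h3.eq_or_lt with h4 | h4
      · rw [h4, div_self hs.ne', one_smul, add_sub_cancel] at h2
        have : p = v + (1 - c * (1 - τ)) • (w - v) := by rw [hp, hv', h2]; module
        rw [this] at hpP
        have h5 : 0 < c * (1 - τ) := mul_pos hc0 (by linarith)
        exact hzP _ (by nlinarith) (by linarith) hpP
      · rw [h2] at hxP
        exact hzP _ (by positivity) ((div_lt_one hs).2 h4) hxP
  have hlt := (ncard_lt_ncard hsub (hP.subset fun x hx => hx.1)).trans_le hk
  have hl' : ∀ l : ℝ, 0 < l → l ≤ 1 → (1 - l) • y' 0 + l • v' ∉ P := by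
    intro l hl0 hl1 hmem
    rw [hy'0] at hmem
    refine hcl l hl0 hl1 ⟨hmem, fun he => hpu ?_⟩
    have he' : (1 - l) • p + l • v' = u := he
    have h1 : (c + l * (1 - c)) • (v' - u) = 0 := by
      rw [← sub_eq_zero] at he'
      rw [← he', hp]; module
    have h2 : 0 ≤ l * (1 - c) := mul_nonneg hl0.le (by linarith [hc.2])
    rcases smul_eq_zero.1 h1 with h3 | h3
    · linarith
    · rw [hp, h3]; simp
  have hr' : ∀ l : ℝ, 0 ≤ l → l < 1 → (1 - l) • v' + l • y' 1 ∉ P := by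
    intro l hl0 hl1
    rw [hy'1, show (1 - l) • v' + l • w = v + (1 - (1 - l) * (1 - τ)) • (w - v) by
      rw [hv']; module]
    have h5 : 0 < (1 - l) * (1 - τ) := mul_pos (by linarith) (by linarith)
    exact hzP _ (by nlinarith) (by linarith)
  obtain ⟨n', x', hx', hlx, hox⟩ := ih _ hlt (Nat.succ_pos n) hy' h' hl' hr' le_rfl
  refine ⟨n', x', hx', hlx.trans ?_, hox.trans ?_⟩
  · rw [hlen']
    have h1 : dist v v' + dist v' w = dist v w := dist_add_smul_sub ⟨hτ0.le, hτ1.le⟩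
    linarith [hlen v, hlen v', dist_triangle u v v']
  · rw [hoff', hoff v hvP, hoff v' hv'P]

/-- A vertex outside `P` can be removed. -/
lemma exists_offCount_add_one (hP : P.Finite) (hn : 0 < n) (hy : Function.Periodic y (n : ℤ))
    (h : ExtPolygon P g (n + 1) (insertVertex n y v)) (hv : v ∉ P) :
    ∃ (n' : ℕ) (x' : ℤ → Pt), ExtPolygon P g n' x' ∧
      edgeSum dist n' x' ≤ edgeSum dist (n + 1) (insertVertex n y v) ∧
      offCount P n' x' + 1 = offCount P (n + 1) (insertVertex n y v) := by
  obtain ⟨m, z, hm, hz, hzE, hzl, hzo, hzc⟩ : ∃ (m : ℕ) (z : ℤ → Pt), 0 < m ∧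
      Function.Periodic z (m : ℤ) ∧ ExtPolygon P g (m + 1) (insertVertex m z v) ∧
      edgeSum dist (m + 1) (insertVertex m z v) = edgeSum dist (n + 1) (insertVertex n y v) ∧
      offCount P (m + 1) (insertVertex m z v) = offCount P (n + 1) (insertVertex n y v) ∧
      ∀ l : ℝ, 0 < l → l ≤ 1 → (1 - l) • z 0 + l • v ∉ P := by
    obtain ⟨c, hc, hcp, hcl⟩ := exists_clear_segment hP (y 0) hv
    rcases hcp with he | hp
    · rw [he] at hcl
      exact ⟨n, y, hn, hy, h, rfl, rfl, hcl⟩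
    · obtain ⟨y', hy', hy'0, -, h1, h2, h3⟩ := subdivide_before hn hy h hc hp
      rw [← hy'0] at hcl
      exact ⟨n + 1, y', Nat.succ_pos n, hy', h1, h2, h3, hcl⟩
  rw [← hzl, ← hzo]
  obtain ⟨c, hc, hcp, hcl⟩ := exists_clear_segment hP (z 1) hv
  have hcl' : ∀ l : ℝ, 0 ≤ l → l < 1 → (1 - l) • v + l • (z 1 + c • (v - z 1)) ∉ P := by
    intro l h0 h1
    have := hcl (1 - l) (by linarith) (by linarith)
    rwa [sub_sub_cancel, add_comm] at this
  rcases hcp with he | hp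
  · rw [he] at hcl'
    exact remove_vertex hP _ hm hz hzE hzc hcl' le_rfl
  · have he : z 1 + c • (v - z 1) = v + (1 - c) • (z 1 - v) := by module
    rw [he] at hp hcl'
    obtain ⟨z', hz', hz'0, hz'1, h1, h2, h3⟩ := subdivide_after hm hz hzE
      ⟨by linarith [hc.2], by linarith [hc.1]⟩ hp
    rw [← hz'0] at hzc
    rw [← hz'1] at hcl'
    rw [← h2, ← h3]
    exact remove_vertex hP _ (Nat.succ_pos m) hz' h1 hzc hcl' le_rfl

/-- Every polygon can be shortened to one with all its vertices in `P` or of length zero. -/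
lemma exists_taut (hP : P.Finite) {x : ℤ → Pt} (h : ExtPolygon P g n x) :
    ∃ (n' : ℕ) (x' : ℤ → Pt), ExtPolygon P g n' x' ∧ edgeSum dist n' x' ≤ edgeSum dist n x ∧
      ((∀ j, x' j ∈ P) ∨ edgeSum dist n' x' = 0) := by
  induction hk : offCount P n x using Nat.strong_induction_on generalizing n x with
  | _ k ih =>
  by_cases hall : ∀ j, x j ∈ P
  · exact ⟨n, x, h, le_rfl, Or.inl hall⟩
  push Not at hall
  obtain ⟨j, hj⟩ := hall
  rw [← periodic_emod h.periodic] at hj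
  obtain ⟨i, hi⟩ := Int.eq_ofNat_of_zero_le
    (Int.emod_nonneg (j + n - 1) (show (n : ℤ) ≠ 0 by have := h.pos; omega))
  have hi1 : x (1 + i) ∉ P := by
    rw [periodic_emod h.periodic] at hj
    rw [← periodic_emod h.periodic, ← hi, Int.add_emod_emod,
      show 1 + (j + (n : ℤ) - 1) = j + n by ring, Int.add_emod_right, periodic_emod h.periodic]
    exact hj
  have hs := h.shift i
  have hsl : edgeSum dist n (fun j => x (j + i)) = edgeSum dist n x :=
    edgeSum_shift dist h.periodic i
  have hso : offCount P n (fun j => x (j + i)) = offCount P n x := edgeSum_shift _ h.periodic i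
  obtain ⟨m, rfl⟩ : ∃ m, n = m + 1 := ⟨n - 1, by have := h.pos; omega⟩
  rcases m.eq_zero_or_pos with rfl | hm
  · refine ⟨_, x, h, le_rfl, Or.inr ?_⟩
    have := h.periodic 0
    simp only [edgeSum, zero_add, Finset.range_one, Finset.sum_singleton, Nat.cast_zero,
      Nat.cast_one] at this ⊢
    rw [this, dist_self]
  · obtain ⟨y, hy, hxy⟩ := exists_eq_insertVertex hm hs.periodic
    rw [← hsl]
    rw [hxy] at hs hsl hso ⊢
    obtain ⟨n', x', hx', hl', ho'⟩ := exists_offCount_add_one hP hm hy hs hi1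
    obtain ⟨n'', x'', hx'', hl'', ht⟩ := ih _ (by omega) hx' rfl
    exact ⟨n'', x'', hx'', hl''.trans hl', ht⟩

end ExtPolygon

namespace PLLoop

variable (γ : PLLoop)

/-- The vertices of a piecewise-linear loop as a periodic sequence. -/
def vertices (j : ℤ) : Pt := γ.v (j : ZMod γ.m)

lemma vertices_periodic : Function.Periodic γ.vertices (γ.m : ℤ) := fun j => by
  simp [vertices]

lemma toFun_eq_interp : γ.toFun = fun t => interp γ.vertices (γ.m * t) := by
  funext t
  have h : (γ.m : ℝ) * t = Int.fract t * γ.m + ((⌊t⌋ * γ.m : ℤ) : ℝ) := by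
    push_cast
    rw [Int.fract]; ring
  have hp : (fun j => γ.vertices (j + ⌊t⌋ * γ.m)) = γ.vertices :=
    funext fun j => by simpa using γ.vertices_periodic.int_mul ⌊t⌋ j
  rw [h, interp_add_int, hp]
  rfl

lemma length_eq_edgeSum : γ.length = edgeSum dist γ.m γ.vertices := by
  simp [length, edgeSum, vertices]

lemma exists_vertices_eq {n : ℕ} {x : ℤ → Pt} (hn : 0 < n) (hx : Function.Periodic x (n : ℤ)) :
    ∃ δ : PLLoop, δ.m = n ∧ δ.vertices = x :=
  ⟨⟨n, hn, fun i => x i.cast⟩, rfl, funext fun j => by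
    simp only [vertices, ZMod.coe_intCast, periodic_emod hx]⟩

end PLLoop

lemma homotopicRelExt_iff_extPolygon {P : Set Pt} {γ δ : PLLoop} :
    HomotopicRelExt P γ δ ↔ ExtPolygon P γ.toFun δ.m δ.vertices := by
  constructor
  · intro h
    have h' : ExtHtpy P γ.toFun δ.toFun := h
    rw [δ.toFun_eq_interp] at h'
    exact ⟨δ.m_pos, δ.vertices_periodic, h'⟩
  · intro h
    have h' := h.extHtpy
    rw [← δ.toFun_eq_interp] at h'
    exact h'

lemma homotopicRelExt_refl {P : Set Pt} {γ : PLLoop} (hγ : γ.image ∩ P = ∅) :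
    HomotopicRelExt P γ γ := by
  have hc := continuous_interp γ.vertices
  refine ExtHtpy.refl ?_ (fun s => ?_) fun s hs => ?_
  · rw [γ.toFun_eq_interp]; fun_prop
  · simp only [γ.toFun_eq_interp, mul_add, mul_one,
      ExtPolygon.interp_periodic γ.vertices_periodic]
  · exact (eq_empty_iff_forall_notMem.1 hγ) _ ⟨⟨s, rfl⟩, hs⟩

/-- The lengths of polygons with vertices in a finite set are well-ordered. -/
lemma isWF_edgeSum {P : Set Pt} (hP : P.Finite) :
    {L : ℝ | ∃ (n : ℕ) (x : ℤ → Pt), (∀ j, x j ∈ P) ∧ edgeSum dist n x = L}.IsWF := by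
  have hfin : (image2 dist P P).Finite := hP.image2 _ hP
  have hpwo := hfin.isPWO.addSubmonoid_closure (by
    rintro _ ⟨p, -, q, -, rfl⟩
    exact dist_nonneg)
  refine hpwo.isWF.mono ?_
  rintro _ ⟨n, x, hx, rfl⟩
  exact sum_mem fun j _ => AddSubmonoid.subset_closure ⟨_, hx _, _, hx _, rfl⟩

/-- For a finite obstacle set `P` and a piecewise-linear loop `γ`
whose image is disjoint from `P`, there exists a piecewise-linear loop `δ`
homotopic rel `P` in the extended sense to `γ` of minimal length. -/
theorem exists_shortest_homotopic_loop (P : Set Pt) (hP : P.Finite)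
    (γ : PLLoop) (hγ : γ.image ∩ P = ∅) :
    ∃ δ : PLLoop, HomotopicRelExt P γ δ ∧
      ∀ δ' : PLLoop, HomotopicRelExt P γ δ' → δ.length ≤ δ'.length := by
  set A : Set ℝ := {L | ∃ (n : ℕ) (x : ℤ → Pt), ExtPolygon P γ.toFun n x ∧
    ((∀ j, x j ∈ P) ∨ edgeSum dist n x = 0) ∧ edgeSum dist n x = L}
  have hA : A.IsWF := by
    refine ((isWF_edgeSum hP).union (finite_singleton (0 : ℝ)).isWF).mono ?_
    rintro _ ⟨n, x, -, hx | hx, rfl⟩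
    · exact Or.inl ⟨n, x, hx, rfl⟩
    · exact Or.inr hx
  have hle : ∀ δ' : PLLoop, HomotopicRelExt P γ δ' → ∃ L ∈ A, L ≤ δ'.length := fun δ' h => by
    obtain ⟨n, x, hx, hl, ht⟩ := (homotopicRelExt_iff_extPolygon.1 h).exists_taut hP
    exact ⟨_, ⟨n, x, hx, ht, rfl⟩, hl.trans δ'.length_eq_edgeSum.ge⟩
  have hne : A.Nonempty := by
    obtain ⟨L, hL, -⟩ := hle γ (homotopicRelExt_refl hγ)
    exact ⟨L, hL⟩
  obtain ⟨n, x, hx, -, hlen⟩ := hA.min_mem hne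
  obtain ⟨δ, rfl, rfl⟩ := PLLoop.exists_vertices_eq hx.pos hx.periodic
  refine ⟨δ, homotopicRelExt_iff_extPolygon.2 hx, fun δ' h => ?_⟩
  obtain ⟨L, hL, hLle⟩ := hle δ' h
  rw [δ.length_eq_edgeSum, hlen]
  exact (hA.min_le hne hL).trans hLle

end
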